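/- Let Ω ⊂ ℂⁿ be a smooth bounded pseudoconvex domain with smooth defining function ρ, let P ∈ bΩ, and let T be a (1,0) vector field with smooth coefficients (T_1, …, T_n) on a neighborhood V of P that is complex tangential along the boundary, i.e., Σ_j T_j (∂ρ/∂z_j) = 0 on bΩ ∩ V. Then for every w ∈ N(P), Σ_j (∂ρ/∂z_j)(P) · Σ_k w̄_k (∂T_j/∂z̄_k)(P) = 0; equivalently, the normal (1,0)-component ∂ρ([T, Ȳ]) of the commutator of T with Ȳ = Σ_k w̄_k ∂/∂z̄_k vanishes at P. (Thus complex tangential fields do not contribute to the normal component of commutators in Levi null directions.) -/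

import Mathlib

open Complex BigOperators

noncomputable section

/-- The Wirtinger derivative `∂f/∂z_j` of `f : ℂⁿ → ℂ` at `z`:
`(1/2)(∂f/∂x_j − i ∂f/∂y_j)`, where the real directional derivatives are taken in the
directions `e_j` and `i·e_j` respectively. -/
def wDz (n : ℕ) (f : (Fin n → ℂ) → ℂ) (j : Fin n) (z : Fin n → ℂ) : ℂ :=
  (1 / 2 : ℂ) *
    (fderiv ℝ f z (Pi.single j 1) - Complex.I * fderiv ℝ f z (Pi.single j Complex.I))

/-- The Wirtinger derivative `∂f/∂z̄_j` of `f : ℂⁿ → ℂ` at `z`: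
`(1/2)(∂f/∂x_j + i ∂f/∂y_j)`. -/
def wDzbar (n : ℕ) (f : (Fin n → ℂ) → ℂ) (j : Fin n) (z : Fin n → ℂ) : ℂ :=
  (1 / 2 : ℂ) *
    (fderiv ℝ f z (Pi.single j 1) + Complex.I * fderiv ℝ f z (Pi.single j Complex.I))

/-- A real-valued function on `ℂⁿ` viewed as complex-valued. -/
def cplx (n : ℕ) (ρ : (Fin n → ℂ) → ℝ) : (Fin n → ℂ) → ℂ := fun z => (ρ z : ℂ)

/-- The complex Hessian (Levi form) `L_ρ(ζ, w̄)(P) = Σ_{j,k} ∂²ρ/∂z_j∂z̄_k (P) ζ_j w̄_k`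
of a real-valued function `ρ`. -/
def levi (n : ℕ) (ρ : (Fin n → ℂ) → ℝ) (P : Fin n → ℂ) (ζ w : Fin n → ℂ) : ℂ :=
  ∑ j, ∑ k,
    wDzbar n (fun z => wDz n (cplx n ρ) j z) k P * ζ j * (starRingEnd ℂ) (w k)

/-- The squared Euclidean norm of the real gradient of a real-valued function `ρ` on `ℂⁿ`:
`|∇ρ|² = 4 Σ_j |∂ρ/∂z_j|²`. -/
def gradSq (n : ℕ) (ρ : (Fin n → ℂ) → ℝ) (z : Fin n → ℂ) : ℝ :=
  4 * ∑ j, Complex.normSq (wDz n (cplx n ρ) j z)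

/-- The squared Euclidean norm `|w|²` of a vector `w ∈ ℂⁿ`. -/
def vnormSq (n : ℕ) (w : Fin n → ℂ) : ℝ := ∑ j, Complex.normSq (w j)

/-- The complex tangent space `T^{1,0}_P(bΩ) = {ζ : Σ_j ζ_j ∂ρ/∂z_j (P) = 0}`. -/
def cTangent (n : ℕ) (ρ : (Fin n → ℂ) → ℝ) (P : Fin n → ℂ) : Set (Fin n → ℂ) :=
  {ζ | ∑ j, ζ j * wDz n (cplx n ρ) j P = 0}

/-- The null space `N(P)` of the Levi form at `P`. -/
def leviNull (n : ℕ) (ρ : (Fin n → ℂ) → ℝ) (P : Fin n → ℂ) : Set (Fin n → ℂ) :=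
  {ζ | ζ ∈ cTangent n ρ P ∧ levi n ρ P ζ ζ = 0}

/-- The complex normal `L_n(P)`, the vector with `j`-th coefficient
`(2/|∇ρ|²) ∂ρ/∂z̄_j (P)`. -/
def cNormal (n : ℕ) (ρ : (Fin n → ℂ) → ℝ) (P : Fin n → ℂ) : Fin n → ℂ :=
  fun j => ((2 / gradSq n ρ P : ℝ) : ℂ) * wDzbar n (cplx n ρ) j P

/-- The complex linear span of `N(P)` and `L_n(P)`. -/
def nullNormalSpan (n : ℕ) (ρ : (Fin n → ℂ) → ℝ) (P : Fin n → ℂ) :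
    Submodule ℂ (Fin n → ℂ) :=
  Submodule.span ℂ (leviNull n ρ P ∪ {cNormal n ρ P})

/-- `ρ` is a smooth defining function for the domain `Ω`: it is smooth, `Ω = {ρ < 0}` and
`bΩ = {ρ = 0}` within a neighborhood `U` of the closure of `Ω`, and `∇ρ ≠ 0` on `bΩ`. -/
def IsDefining (n : ℕ) (Ω : Set (Fin n → ℂ)) (ρ : (Fin n → ℂ) → ℝ) : Prop :=
  ContDiff ℝ (⊤ : ℕ∞) ρ ∧
  ∃ U : Set (Fin n → ℂ), IsOpen U ∧ closure Ω ⊆ U ∧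
    Ω = {z | z ∈ U ∧ ρ z < 0} ∧
    frontier Ω = {z | z ∈ U ∧ ρ z = 0} ∧
    ∀ z ∈ frontier Ω, fderiv ℝ ρ z ≠ 0

/-- `Ω` (with defining function `ρ`) is pseudoconvex: the Levi form of `ρ` is positive
semidefinite on the complex tangent space at every boundary point. -/
def Pseudoconvex (n : ℕ) (Ω : Set (Fin n → ℂ)) (ρ : (Fin n → ℂ) → ℝ) : Prop :=
  ∀ P ∈ frontier Ω, ∀ ζ ∈ cTangent n ρ P, 0 ≤ (levi n ρ P ζ ζ).re

lemma fderiv_cplx {n : ℕ} {ρ : (Fin n → ℂ) → ℝ} {z : Fin n → ℂ}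
    (h : DifferentiableAt ℝ ρ z) (v : Fin n → ℂ) :
    fderiv ℝ (cplx n ρ) z v = (fderiv ℝ ρ z v : ℂ) := by
  have h' : HasFDerivAt (cplx n ρ) (Complex.ofRealCLM.comp (fderiv ℝ ρ z)) z :=
    Complex.ofRealCLM.hasFDerivAt.comp z h.hasFDerivAt
  simp [h'.fderiv]

lemma wDz_cplx {n : ℕ} {ρ : (Fin n → ℂ) → ℝ} (h : Differentiable ℝ ρ) (j : Fin n) :
    wDz n (cplx n ρ) j = fun z => (1 / 2 : ℂ) *
      ((fderiv ℝ ρ z (Pi.single j 1) : ℂ) -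
        Complex.I * (fderiv ℝ ρ z (Pi.single j Complex.I) : ℂ)) := by
  funext z
  simp only [wDz, fderiv_cplx (h z)]

lemma conj_wDz_cplx {n : ℕ} {ρ : (Fin n → ℂ) → ℝ} {z : Fin n → ℂ}
    (h : DifferentiableAt ℝ ρ z) (j : Fin n) :
    (starRingEnd ℂ) (wDz n (cplx n ρ) j z) = wDzbar n (cplx n ρ) j z := by
  simp only [wDz, wDzbar, fderiv_cplx h]
  simp [Complex.conj_ofNat]

lemma hasFDerivAt_fderiv_apply_ofReal {n : ℕ} {ρ : (Fin n → ℂ) → ℝ}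
    (hρ : ContDiff ℝ (⊤ : ℕ∞) ρ) (P v : Fin n → ℂ) :
    HasFDerivAt (fun z => (fderiv ℝ ρ z v : ℂ))
      (Complex.ofRealCLM.comp ((fderiv ℝ (fderiv ℝ ρ) P).flip v)) P := by
  have hd : DifferentiableAt ℝ (fderiv ℝ ρ) P :=
    ((hρ.fderiv_right (m := 1) (by norm_cast)).differentiable (by simp)) P
  have := hd.hasFDerivAt.clm_apply (hasFDerivAt_const v P)
  refine (Complex.ofRealCLM.hasFDerivAt.comp P this).congr_fderiv ?_
  ext u
  simp

lemma hasFDerivAt_wDz_cplx {n : ℕ} {ρ : (Fin n → ℂ) → ℝ}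
    (hρ : ContDiff ℝ (⊤ : ℕ∞) ρ) (P : Fin n → ℂ) (j : Fin n) :
    HasFDerivAt (wDz n (cplx n ρ) j)
      ((1 / 2 : ℂ) •
        (Complex.ofRealCLM.comp ((fderiv ℝ (fderiv ℝ ρ) P).flip (Pi.single j 1)) -
        Complex.I •
          Complex.ofRealCLM.comp
            ((fderiv ℝ (fderiv ℝ ρ) P).flip (Pi.single j Complex.I)))) P := by
  rw [wDz_cplx (hρ.differentiable (by simp))]
  exact ((hasFDerivAt_fderiv_apply_ofReal hρ P _).sub
    ((hasFDerivAt_fderiv_apply_ofReal hρ P _).const_mul Complex.I)).const_mul _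

/-- The complex Hessian matrix of a smooth real-valued function is Hermitian. -/
lemma conj_wDzbar_wDz_cplx {n : ℕ} {ρ : (Fin n → ℂ) → ℝ}
    (hρ : ContDiff ℝ (⊤ : ℕ∞) ρ) (P : Fin n → ℂ) (j k : Fin n) :
    (starRingEnd ℂ) (wDzbar n (wDz n (cplx n ρ) j) k P) =
      wDzbar n (wDz n (cplx n ρ) k) j P := by
  have hs : IsSymmSndFDerivAt ℝ ρ P :=
    hρ.contDiffAt.isSymmSndFDerivAt (by simp; norm_cast)
  simp only [wDzbar, (hasFDerivAt_wDz_cplx hρ P _).fderiv]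
  simp [hs (Pi.single j _) (Pi.single k _), Complex.conj_ofNat]
  ring

lemma levi_conj_symm {n : ℕ} {ρ : (Fin n → ℂ) → ℝ}
    (hρ : ContDiff ℝ (⊤ : ℕ∞) ρ) (P ζ w : Fin n → ℂ) :
    (starRingEnd ℂ) (levi n ρ P ζ w) = levi n ρ P w ζ := by
  simp only [levi, map_sum, map_mul, conj_wDzbar_wDz_cplx hρ, Complex.conj_conj]
  rw [Finset.sum_comm]
  exact Finset.sum_congr rfl fun j _ => Finset.sum_congr rfl fun k _ => by ring

lemma levi_add_left (n : ℕ) (ρ : (Fin n → ℂ) → ℝ) (P ζ ξ w : Fin n → ℂ) :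
    levi n ρ P (ζ + ξ) w = levi n ρ P ζ w + levi n ρ P ξ w := by
  simp only [levi, Pi.add_apply, mul_add, add_mul, Finset.sum_add_distrib]

lemma levi_add_right (n : ℕ) (ρ : (Fin n → ℂ) → ℝ) (P ζ w ξ : Fin n → ℂ) :
    levi n ρ P ζ (w + ξ) = levi n ρ P ζ w + levi n ρ P ζ ξ := by
  simp only [levi, Pi.add_apply, map_add, mul_add, Finset.sum_add_distrib]

lemma levi_smul_left (n : ℕ) (ρ : (Fin n → ℂ) → ℝ) (P ζ w : Fin n → ℂ) (c : ℂ) :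
    levi n ρ P (c • ζ) w = c * levi n ρ P ζ w := by
  simp only [levi, Pi.smul_apply, smul_eq_mul, Finset.mul_sum]
  exact Finset.sum_congr rfl fun j _ => Finset.sum_congr rfl fun k _ => by ring

lemma levi_smul_right (n : ℕ) (ρ : (Fin n → ℂ) → ℝ) (P ζ w : Fin n → ℂ) (c : ℂ) :
    levi n ρ P ζ (c • w) = (starRingEnd ℂ) c * levi n ρ P ζ w := by
  simp only [levi, Pi.smul_apply, smul_eq_mul, Finset.mul_sum, map_mul]
  exact Finset.sum_congr rfl fun j _ => Finset.sum_congr rfl fun k _ => by ring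

lemma eq_zero_of_forall_nonneg_quadratic {a b : ℝ}
    (h : ∀ t : ℝ, 0 ≤ t ^ 2 * a + t * b) : b = 0 := by
  have := discrim_le_zero (a := a) (b := b) (c := 0) fun t => by linarith [h t]
  rw [discrim] at this
  nlinarith

/-- A null vector of a Levi form that is positive semidefinite on the complex tangent space is
Levi-orthogonal to the whole complex tangent space. -/
lemma levi_eq_zero_of_mem_leviNull {n : ℕ} {ρ : (Fin n → ℂ) → ℝ}
    (hρ : ContDiff ℝ (⊤ : ℕ∞) ρ) {P : Fin n → ℂ}
    (hpos : ∀ ζ ∈ cTangent n ρ P, 0 ≤ (levi n ρ P ζ ζ).re)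
    {ζ w : Fin n → ℂ} (hζ : ζ ∈ cTangent n ρ P) (hw : w ∈ leviNull n ρ P) :
    levi n ρ P ζ w = 0 := by
  obtain ⟨hwt, hw0⟩ := hw
  set a := levi n ρ P ζ w with ha
  have hwz : levi n ρ P w ζ = (starRingEnd ℂ) a := (levi_conj_symm hρ P ζ w).symm
  have hb : 2 * Complex.normSq a = 0 := by
    refine eq_zero_of_forall_nonneg_quadratic
      (a := (levi n ρ P ζ ζ).re * Complex.normSq a) fun t => ?_
    have hmem : ((t : ℂ) * (starRingEnd ℂ) a) • ζ + w ∈ cTangent n ρ P := by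
      simp only [cTangent, Set.mem_ofPred_eq, Pi.add_apply, Pi.smul_apply, smul_eq_mul, add_mul,
        mul_assoc, Finset.sum_add_distrib, ← Finset.mul_sum] at hζ hwt ⊢
      rw [hζ, hwt]
      simp
    have := hpos _ hmem
    simp only [levi_add_left, levi_add_right, levi_smul_left, levi_smul_right, hw0, hwz,
      ← ha] at this
    simp [Complex.normSq_apply] at this ⊢
    linarith
  simpa using hb

/-- If `g` vanishes on the level set of `ρ` through `P` near `P`, then the differential of `g` at
`P` is a multiple of that of `ρ`. -/
lemma exists_fderiv_eq_smul_of_eventually_eq_zero {E : Type*} [NormedAddCommGroup E]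
    [NormedSpace ℝ E] [CompleteSpace E] {ρ g : E → ℝ} {ρ' g' : E →L[ℝ] ℝ} {P : E}
    (hρ : HasStrictFDerivAt ρ ρ' P) (hg : HasStrictFDerivAt g g' P) (hρ' : ρ' ≠ 0)
    (h : ∀ᶠ z in nhds P, ρ z = ρ P → g z = 0) : ∃ c : ℝ, g' = c • ρ' := by
  have hext : IsLocalExtrOn g {z | ρ z = ρ P} P := by
    left
    have hP := h.self_of_nhds rfl
    refine eventually_nhdsWithin_iff.mpr (h.mono fun z hz hzs => ?_)
    rw [hP, hz hzs]
  obtain ⟨a, b, hab, hsum⟩ := hext.exists_multipliers_of_hasStrictFDerivAt_1d hρ hg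
  have hb : b ≠ 0 := by
    rintro rfl
    have ha : a ≠ 0 := fun ha => hab (by rw [ha, Prod.mk_zero_zero])
    rw [zero_smul, add_zero] at hsum
    exact (smul_ne_zero ha hρ') hsum
  refine ⟨-(b⁻¹ * a), ?_⟩
  have : b⁻¹ • (a • ρ' + b • g') = 0 := by rw [hsum, smul_zero]
  rw [smul_add, smul_smul, smul_smul, inv_mul_cancel₀ hb, one_smul] at this
  exact (eq_neg_of_add_eq_zero_right this).trans (neg_smul _ _).symm

/-- A complex-valued function vanishing on the level set of `ρ` through `P` near `P` has its
Wirtinger derivatives `∂/∂z̄_k` at `P` proportional to those of `ρ`. -/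
lemma exists_wDzbar_eq_mul_of_eventually_eq_zero {n : ℕ} {ρ : (Fin n → ℂ) → ℝ}
    {F : (Fin n → ℂ) → ℂ} {P : Fin n → ℂ} (hρ : ContDiffAt ℝ 1 ρ P) (hF : ContDiffAt ℝ 1 F P)
    (hρ' : fderiv ℝ ρ P ≠ 0) (h : ∀ᶠ z in nhds P, ρ z = ρ P → F z = 0) :
    ∃ c : ℂ, ∀ k, wDzbar n F k P = c * wDzbar n (cplx n ρ) k P := by
  have hρs := hρ.hasStrictFDerivAt (by simp)
  have hFs := hF.hasStrictFDerivAt (by simp)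
  obtain ⟨a, ha⟩ := exists_fderiv_eq_smul_of_eventually_eq_zero hρs
    (Complex.reCLM.hasStrictFDerivAt.comp P hFs) hρ'
    (h.mono fun z hz hzρ => by simp [hz hzρ])
  obtain ⟨b, hb⟩ := exists_fderiv_eq_smul_of_eventually_eq_zero hρs
    (Complex.imCLM.hasStrictFDerivAt.comp P hFs) hρ'
    (h.mono fun z hz hzρ => by simp [hz hzρ])
  have hc : ∀ v, fderiv ℝ F P v = (⟨a, b⟩ : ℂ) * (fderiv ℝ ρ P v : ℂ) := fun v => by
    have h1 := DFunLike.congr_fun ha v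
    have h2 := DFunLike.congr_fun hb v
    apply Complex.ext
    · simpa using h1
    · simpa using h2
  refine ⟨⟨a, b⟩, fun k => ?_⟩
  simp only [wDzbar, hc, fderiv_cplx (hρ.differentiableAt (by simp))]
  ring

lemma wDzbar_sum_mul {n : ℕ} {f g : Fin n → (Fin n → ℂ) → ℂ} {P : Fin n → ℂ}
    (hf : ∀ j, DifferentiableAt ℝ (f j) P) (hg : ∀ j, DifferentiableAt ℝ (g j) P) (k : Fin n) :
    wDzbar n (fun z => ∑ j, f j z * g j z) k P =
      ∑ j, (g j P * wDzbar n (f j) k P + f j P * wDzbar n (g j) k P) := by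
  have h := HasFDerivAt.fun_sum (u := Finset.univ)
    fun j _ => (hf j).hasFDerivAt.fun_mul (hg j).hasFDerivAt
  simp only [wDzbar]
  rw [h.fderiv]
  simp only [sum_apply, add_apply, smul_apply, smul_eq_mul, Finset.mul_sum, ← Finset.sum_add_distrib]
  exact Finset.sum_congr rfl fun j _ => by ring

/-- a (1,0) vector field `T` that is complex tangential along the boundary
of a smooth bounded pseudoconvex domain does not contribute to the normal
(1,0)-component of commutators in Levi null directions: for `w ∈ N(P)`,
`Σ_j ∂ρ/∂z_j(P) · Σ_k w̄_k ∂T_j/∂z̄_k(P) = 0`. -/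
theorem tangential_field_no_normal_commutator (n : ℕ) (Ω : Set (Fin n → ℂ))
    (hΩ : Bornology.IsBounded Ω) (ρ : (Fin n → ℂ) → ℝ) (hρ : IsDefining n Ω ρ)
    (hpsc : Pseudoconvex n Ω ρ) (P : Fin n → ℂ) (hP : P ∈ frontier Ω)
    (V : Set (Fin n → ℂ)) (hV : IsOpen V) (hPV : P ∈ V)
    (T : Fin n → (Fin n → ℂ) → ℂ) (hT : ∀ j, ContDiffOn ℝ (⊤ : ℕ∞) (T j) V)
    (htang : ∀ z ∈ frontier Ω ∩ V, ∑ j, T j z * wDz n (cplx n ρ) j z = 0)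
    (w : Fin n → ℂ) (hw : w ∈ leviNull n ρ P) :
    ∑ j, wDz n (cplx n ρ) j P *
        (∑ k, (starRingEnd ℂ) (w k) * wDzbar n (T j) k P) = 0 := by
  obtain ⟨hsm, U, hU, hΩU, -, hfr, hgrad⟩ := hρ
  have hρ0 : ρ P = 0 := by
    rw [hfr] at hP
    exact hP.2
  have hTP : ∀ j, ContDiffAt ℝ 1 (T j) P := fun j =>
    ((hT j).contDiffAt (hV.mem_nhds hPV)).of_le (by norm_cast)
  have hrP : ∀ j, ContDiffAt ℝ 1 (wDz n (cplx n ρ) j) P := fun j => by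
    have hd : ContDiff ℝ 1 (fderiv ℝ ρ) := hsm.fderiv_right (by norm_cast)
    have hd' : ∀ v, ContDiff ℝ 1 fun z => (fderiv ℝ ρ z v : ℂ) := fun v =>
      Complex.ofRealCLM.contDiff.comp (hd.clm_apply contDiff_const)
    rw [wDz_cplx (hsm.differentiable (by simp))]
    exact (contDiff_const.mul ((hd' _).sub (contDiff_const.mul (hd' _)))).contDiffAt
  obtain ⟨c, hc⟩ := exists_wDzbar_eq_mul_of_eventually_eq_zero
    (F := fun z => ∑ j, T j z * wDz n (cplx n ρ) j z)
    (hsm.contDiffAt.of_le (by norm_cast))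
    (ContDiffAt.sum fun j _ => (hTP j).mul (hrP j)) (hgrad P hP) (by
      filter_upwards [hV.mem_nhds hPV, hU.mem_nhds (hΩU hP.1)] with z hzV hzU hz
      refine htang z ⟨?_, hzV⟩
      rw [hfr]
      exact ⟨hzU, hz.trans hρ0⟩)
  have hlevi := levi_eq_zero_of_mem_leviNull hsm (hpsc P hP) (ζ := fun j => T j P)
    (htang P ⟨hP, hPV⟩) hw
  have hwbar : ∑ k, (starRingEnd ℂ) (w k) * wDzbar n (cplx n ρ) k P = 0 := by
    have := congrArg (starRingEnd ℂ) hw.1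
    simpa only [map_sum, map_mul, map_zero,
      conj_wDz_cplx (hsm.differentiable (by simp) P)] using this
  have hsum : ∑ k, (starRingEnd ℂ) (w k) *
      wDzbar n (fun z => ∑ j, T j z * wDz n (cplx n ρ) j z) k P = 0 := by
    simp only [hc, mul_left_comm _ c, ← Finset.mul_sum, hwbar, mul_zero]
  simp only [wDzbar_sum_mul (fun j => (hTP j).differentiableAt (by simp))
    (fun j => (hrP j).differentiableAt (by simp)), Finset.mul_sum, mul_add,
    Finset.sum_add_distrib] at hsum
  rw [Finset.sum_comm, Finset.sum_comm (f := fun k j => _ * (T j P * _))] at hsum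
  have hlevi' : ∑ j, ∑ k, (starRingEnd ℂ) (w k) *
      (T j P * wDzbar n (wDz n (cplx n ρ) j) k P) = 0 := by
    rw [← hlevi, levi]
    exact Finset.sum_congr rfl fun j _ => Finset.sum_congr rfl fun k _ => by ring
  rw [hlevi', add_zero] at hsum
  rw [← hsum]
  simp only [Finset.mul_sum]
  exact Finset.sum_congr rfl fun j _ => Finset.sum_congr rfl fun k _ => by ring
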